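/- Let M ∈ ℝ^{2n×2n} be symmetric positive-definite with symplectic eigenvalues d₁ ≤ ... ≤ dₙ and let 1 ≤ k ≤ n. Every local minimizer of f(X) = tr(XᵀMX) on Sp(2k,2n) is a global minimizer: if X₀ ∈ Sp(2k,2n) and there exists ε > 0 such that f(X₀) ≤ f(X) for all X ∈ Sp(2k,2n) with ‖X − X₀‖ < ε, then f(X₀) = 2(d₁ + ... + d_k). -/

import Mathlib

open Matrix

noncomputable section

/-- Index type for `2n`-dimensional objects: first copy for indices `1..n`,
second copy for indices `n+1..2n`. -/
abbrev Idx (n : ℕ) := Fin n ⊕ Fin n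

/-- The Poisson matrix `J_{2n} = [[0, I], [-I, 0]]`. -/
def Jmat (n : ℕ) : Matrix (Idx n) (Idx n) ℝ := fromBlocks 0 1 (-1) 0

/-- `X ∈ Sp(2k, 2n)`, i.e. `Xᵀ J_{2n} X = J_{2k}`. -/
def Symplectic {n k : ℕ} (X : Matrix (Idx n) (Idx k) ℝ) : Prop :=
  Xᵀ * Jmat n * X = Jmat k

/-- `K ∈ OrSp(2n)`, i.e. `KᵀK = I` and `Kᵀ J K = J`. -/
def OrthoSymplectic {n : ℕ} (K : Matrix (Idx n) (Idx n) ℝ) : Prop :=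
  Kᵀ * K = 1 ∧ Symplectic K

/-- The block-diagonal matrix `diag(D, D)` with `D = diagonal d`. -/
def diagPair {n : ℕ} (d : Fin n → ℝ) : Matrix (Idx n) (Idx n) ℝ :=
  fromBlocks (diagonal d) 0 0 (diagonal d)

/-- The matrix `[[0, -Λ], [Λ, 0]]` with `Λ = diagonal lam`. -/
def offPair {k : ℕ} (lam : Fin k → ℝ) : Matrix (Idx k) (Idx k) ℝ :=
  fromBlocks 0 (-(diagonal lam)) (diagonal lam) 0

attribute [local instance] Matrix.normedAddCommGroup

lemma Jmat_transpose (n : ℕ) : (Jmat n)ᵀ = -Jmat n := by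
  simp [Jmat, fromBlocks_transpose, fromBlocks_neg]

lemma Jmat_mul_Jmat (n : ℕ) : Jmat n * Jmat n = -1 := by
  simp [Jmat, fromBlocks_multiply, ← fromBlocks_one, fromBlocks_neg]

lemma diagPair_eq_diagonal {n : ℕ} (d : Fin n → ℝ) :
    diagPair d = diagonal (Sum.elim d d) := by
  simp [diagPair, fromBlocks_diagonal]

lemma diagPair_transpose {n : ℕ} (d : Fin n → ℝ) : (diagPair d)ᵀ = diagPair d := by
  simp [diagPair_eq_diagonal]

lemma diagPair_mul_Jmat {n : ℕ} (d : Fin n → ℝ) :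
    diagPair d * Jmat n = Jmat n * diagPair d := by
  simp only [diagPair, Jmat, fromBlocks_multiply]
  simp

lemma Symplectic.mul {n m k : ℕ} {S : Matrix (Idx n) (Idx m) ℝ} {X : Matrix (Idx m) (Idx k) ℝ}
    (hS : Symplectic S) (hX : Symplectic X) : Symplectic (S * X) := by
  unfold Symplectic at *
  rw [← hX, ← hS, transpose_mul]
  simp only [Matrix.mul_assoc]

lemma Symplectic.left_inverse {n : ℕ} {S : Matrix (Idx n) (Idx n) ℝ} (hS : Symplectic S) :
    -(Jmat n * Sᵀ * Jmat n) * S = 1 := by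
  unfold Symplectic at hS
  rw [Matrix.neg_mul, Matrix.mul_assoc, Matrix.mul_assoc, ← Matrix.mul_assoc Sᵀ, hS,
    Jmat_mul_Jmat, neg_neg]

lemma Symplectic.inv {n : ℕ} {S : Matrix (Idx n) (Idx n) ℝ} (hS : Symplectic S) :
    Symplectic S⁻¹ := by
  have h1 : S * S⁻¹ = 1 := mul_nonsing_inv _ (isUnit_det_of_left_inverse hS.left_inverse)
  have h2 : S⁻¹ᵀ * Sᵀ = 1 := by rw [← transpose_mul, h1, transpose_one]
  unfold Symplectic at *
  calc S⁻¹ᵀ * Jmat n * S⁻¹ = S⁻¹ᵀ * (Sᵀ * Jmat n * S) * S⁻¹ := by rw [hS]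
    _ = (S⁻¹ᵀ * Sᵀ) * Jmat n * (S * S⁻¹) := by simp only [Matrix.mul_assoc]
    _ = Jmat n := by rw [h1, h2, Matrix.one_mul, Matrix.mul_one]

lemma eq_zero_of_transpose_mul_self_add {l m n : Type*} [Fintype l] [Fintype m] [Fintype n]
    (A : Matrix l n ℝ) (B : Matrix m n ℝ) (h : Aᵀ * A + Bᵀ * B = 0) : A = 0 := by
  have hA : 0 ≤ (Aᵀ * A).trace := by
    simpa using (posSemidef_conjTranspose_mul_self A).trace_nonneg
  have hB : 0 ≤ (Bᵀ * B).trace := by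
    simpa using (posSemidef_conjTranspose_mul_self B).trace_nonneg
  have ht := congrArg trace h
  rw [trace_add, trace_zero] at ht
  have h0 : (Aᵀ * A).trace = 0 := by linarith
  have h1 : (Aᴴ * A).trace = 0 := by simpa using h0
  exact trace_conjTranspose_mul_self_eq_zero_iff.mp h1

lemma eq_zero_of_transpose_mul_self {m n : Type*} [Fintype m] [Fintype n]
    (A : Matrix m n ℝ) (h : Aᵀ * A = 0) : A = 0 :=
  eq_zero_of_transpose_mul_self_add A A (by rw [h, add_zero])

/-- The symplectic transvection along `w` with parameter `t`. -/
def transvec {n : ℕ} (w : Idx n → ℝ) (t : ℝ) : Matrix (Idx n) (Idx n) ℝ :=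
  1 + t • (vecMulVec w w * Jmat n)

lemma dotProduct_Jmat_mulVec_self {n : ℕ} (w : Idx n → ℝ) : w ⬝ᵥ (Jmat n *ᵥ w) = 0 := by
  have h : w ⬝ᵥ (Jmat n *ᵥ w) = -(w ⬝ᵥ (Jmat n *ᵥ w)) := by
    conv_lhs => rw [dotProduct_mulVec, ← mulVec_transpose, Jmat_transpose, neg_mulVec,
      neg_dotProduct, dotProduct_comm]
  linarith

lemma symplectic_transvec {n : ℕ} (w : Idx n → ℝ) (t : ℝ) : Symplectic (transvec w t) := by
  have h0 : vecMulVec w w * Jmat n * vecMulVec w w = 0 := by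
    rw [Matrix.mul_assoc, mul_vecMulVec, vecMulVec_mul_vecMulVec, dotProduct_Jmat_mulVec_self]
    simp
  unfold Symplectic transvec
  simp only [transpose_add, transpose_one, transpose_smul, transpose_mul, Jmat_transpose,
    transpose_vecMulVec]
  simp only [Matrix.add_mul, Matrix.mul_add, Matrix.one_mul, Matrix.mul_one, Matrix.smul_mul,
    Matrix.mul_smul, Matrix.neg_mul]
  have h1 : Jmat n * vecMulVec w w * Jmat n * (vecMulVec w w * Jmat n) = 0 := by
    calc _ = Jmat n * (vecMulVec w w * Jmat n * vecMulVec w w) * Jmat n := by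
          simp only [Matrix.mul_assoc]
      _ = 0 := by rw [h0]; simp
  rw [h1, Matrix.mul_assoc]
  simp

lemma trace_quadratic_expansion {m l : Type*} [Fintype m] [Fintype l] [DecidableEq m]
    (D A : Matrix m m ℝ) (X : Matrix m l ℝ) (hD : Dᵀ = D) (t : ℝ) :
    (((1 + t • A) * X)ᵀ * D * ((1 + t • A) * X)).trace = (Xᵀ * D * X).trace +
      (2 * (A * (X * Xᵀ) * D).trace * t + ((A * X)ᵀ * D * (A * X)).trace * t ^ 2) := by
  have h1 : ((A * X)ᵀ * D * X).trace = (A * (X * Xᵀ) * D).trace := by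
    rw [← trace_transpose, transpose_mul, transpose_mul, transpose_transpose, hD,
      ← Matrix.mul_assoc, trace_mul_comm]
    simp only [Matrix.mul_assoc]
  have h2 : (Xᵀ * D * (A * X)).trace = (A * (X * Xᵀ) * D).trace := by
    rw [trace_mul_comm]; simp only [Matrix.mul_assoc]
  simp only [Matrix.add_mul, Matrix.one_mul, Matrix.smul_mul, transpose_add, transpose_smul,
    Matrix.mul_add, Matrix.mul_smul, trace_add, trace_smul, smul_eq_mul, h1, h2]
  ring

lemma eq_zero_of_eventually_nonneg {a b : ℝ}
    (h : ∀ᶠ t : ℝ in nhds 0, 0 ≤ a * t + b * t ^ 2) : a = 0 := by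
  have hmin : IsLocalMin (fun t : ℝ => a * t + b * t ^ 2) 0 := by
    filter_upwards [h] with t ht
    simpa using ht
  have hder : HasDerivAt (fun t : ℝ => a * t + b * t ^ 2) a 0 := by
    have := ((hasDerivAt_id (0 : ℝ)).const_mul a).add (((hasDerivAt_id (0 : ℝ)).pow 2).const_mul b)
    exact this.congr_deriv (by simp)
  exact hmin.hasDerivAt_eq_zero hder

section LocalMin

variable {n k : ℕ} {D : Matrix (Idx n) (Idx n) ℝ} {X : Matrix (Idx n) (Idx k) ℝ}

lemma stationarity (hD : Dᵀ = D) (hX : Symplectic X)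
    (hloc : ∀ᶠ Y in nhds X, Symplectic Y → (Xᵀ * D * X).trace ≤ (Yᵀ * D * Y).trace) :
    Jmat n * (X * Xᵀ) * D = D * (X * Xᵀ) * Jmat n := by
  have hquad (w : Idx n → ℝ) : w ⬝ᵥ ((Jmat n * (X * Xᵀ) * D) *ᵥ w) = 0 := by
    have hc : Filter.Tendsto (fun t : ℝ => transvec w t * X) (nhds 0) (nhds X) := by
      have : Continuous (fun t : ℝ => transvec w t * X) := by unfold transvec; fun_prop
      simpa [transvec] using this.tendsto 0
    have hev := eq_zero_of_eventually_nonneg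
      (a := 2 * (vecMulVec w w * Jmat n * (X * Xᵀ) * D).trace)
      (b := ((vecMulVec w w * Jmat n * X)ᵀ * D * (vecMulVec w w * Jmat n * X)).trace) (by
        filter_upwards [hc.eventually hloc] with t ht
        have := ht ((symplectic_transvec w t).mul hX)
        unfold transvec at this
        rw [trace_quadratic_expansion D _ X hD] at this
        linarith)
    have h2 : (vecMulVec w w * Jmat n * (X * Xᵀ) * D).trace
        = w ⬝ᵥ ((Jmat n * (X * Xᵀ) * D) *ᵥ w) := by
      rw [Matrix.mul_assoc, Matrix.mul_assoc, ← Matrix.mul_assoc (Jmat n), trace_mul_comm,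
        mul_vecMulVec, trace_vecMulVec, dotProduct_comm]
    linarith
  set Q := Jmat n * (X * Xᵀ) * D with hQ
  have hQT : Qᵀ = -(D * (X * Xᵀ) * Jmat n) := by
    simp [hQ, transpose_mul, hD, Jmat_transpose, Matrix.mul_assoc]
  have hskew : Q + Qᵀ = 0 := by
    ext a b
    have hab := hquad (Pi.single a 1 + Pi.single b 1)
    have ha := hquad (Pi.single a 1)
    have hb := hquad (Pi.single b 1)
    simp [mulVec_add, add_dotProduct, dotProduct_add] at hab ha hb
    rw [Matrix.add_apply, transpose_apply, Matrix.zero_apply]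
    linarith
  rw [hQT] at hskew
  exact sub_eq_zero.mp (by rw [sub_eq_add_neg]; exact hskew)

lemma gram_commute_diagPair {d : Fin n → ℝ} (hd : ∀ j, 0 < d j) {G : Matrix (Idx n) (Idx n) ℝ}
    (h : Jmat n * G * diagPair d = diagPair d * G * Jmat n) :
    diagPair d * G = G * diagPair d ∧ Jmat n * G = G * Jmat n := by
  set D := diagPair d with hDdef
  set J := Jmat n
  have hJ : J * J = -1 := Jmat_mul_Jmat n
  have hDJ : D * J = J * D := diagPair_mul_Jmat d
  have h1 : G * D * J = D * J * G := by
    have h2 : J * (J * G * D) * J = J * (D * G * J) * J := by rw [h]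
    have h3 : J * (J * G * D) * J = -(G * D * J) := by
      rw [show J * (J * G * D) * J = (J * J) * (G * D * J) by simp only [Matrix.mul_assoc], hJ]
      simp
    have h4 : J * (D * G * J) * J = -(D * J * G) := by
      rw [show J * (D * G * J) * J = (J * D) * G * (J * J) by simp only [Matrix.mul_assoc], hJ,
        hDJ]
      simp
    rw [h3, h4] at h2
    exact neg_injective h2
  have hsq : G * (D * D) = (D * D) * G := by
    have e1 : D * J * (D * J) = -(D * D) := by
      calc D * J * (D * J) = D * (J * D) * J := by simp only [Matrix.mul_assoc]
        _ = D * D * (J * J) := by rw [← hDJ]; simp only [Matrix.mul_assoc]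
        _ = _ := by rw [hJ]; simp
    have e2 : G * (D * J * (D * J)) = (D * J * (D * J)) * G := by
      calc G * (D * J * (D * J)) = (G * D * J) * (D * J) := by simp only [Matrix.mul_assoc]
        _ = D * J * G * (D * J) := by rw [h1]
        _ = D * J * (G * D * J) := by simp only [Matrix.mul_assoc]
        _ = D * J * (D * J * G) := by rw [h1]
        _ = _ := by simp only [Matrix.mul_assoc]
    rw [e1] at e2
    simpa using e2
  have hpos (a : Idx n) : 0 < Sum.elim d d a := by cases a <;> simp [hd]
  have hDG : D * G = G * D := by
    ext a b
    have hab := congrFun (congrFun hsq a) b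
    rw [hDdef, diagPair_eq_diagonal] at hab ⊢
    simp only [diagonal_mul_diagonal, mul_diagonal, diagonal_mul] at hab ⊢
    have h0 : (Sum.elim d d a + Sum.elim d d b) *
        (Sum.elim d d a * G a b - G a b * Sum.elim d d b) = 0 := by linear_combination -hab
    rcases mul_eq_zero.mp h0 with h0 | h0
    · linarith [hpos a, hpos b]
    · linarith
  refine ⟨hDG, ?_⟩
  have h5 : D * (J * G) = D * (G * J) := by
    rw [← Matrix.mul_assoc, ← h1, ← Matrix.mul_assoc, hDG]
  ext a b
  have hab := congrFun (congrFun h5 a) b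
  rw [hDdef, diagPair_eq_diagonal] at hab
  simp only [diagonal_mul] at hab
  exact mul_left_cancel₀ (hpos a).ne' hab

lemma gram_idempotent (hX : Symplectic X) (hJG : Jmat n * (X * Xᵀ) = X * Xᵀ * Jmat n) :
    X * Xᵀ * (X * Xᵀ) = X * Xᵀ ∧ (X * Xᵀ).trace = 2 * k := by
  set G := X * Xᵀ with hG
  have hGT : Gᵀ = G := by simp [hG]
  have hJ : Jmat n * Jmat n = -1 := Jmat_mul_Jmat n
  have hGG : G * G = -(X * (Jmat k * (Xᵀ * Jmat n))) := by
    have h1 : G * Jmat n * G * Jmat n = -(G * G) := by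
      calc G * Jmat n * G * Jmat n = G * (Jmat n * G) * Jmat n := by simp only [Matrix.mul_assoc]
        _ = G * G * (Jmat n * Jmat n) := by rw [hJG]; simp only [Matrix.mul_assoc]
        _ = _ := by rw [hJ]; simp
    have h2 : G * Jmat n * G * Jmat n = X * (Jmat k * (Xᵀ * Jmat n)) := by
      rw [← hX, hG]; simp only [Matrix.mul_assoc]
    rw [← h2, h1, neg_neg]
  have h4 : (G * G) * (G * G) = G * G := by
    rw [hGG]
    simp only [Matrix.neg_mul, Matrix.mul_neg, neg_neg]
    calc X * (Jmat k * (Xᵀ * Jmat n)) * (X * (Jmat k * (Xᵀ * Jmat n)))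
        = X * (Jmat k * (Xᵀ * Jmat n * X) * (Jmat k * (Xᵀ * Jmat n))) := by
          simp only [Matrix.mul_assoc]
      _ = -(X * (Jmat k * (Xᵀ * Jmat n))) := by
          rw [hX, Jmat_mul_Jmat]; simp
  have h3 : G * G * G = G := by
    refine sub_eq_zero.mp (eq_zero_of_transpose_mul_self _ ?_)
    have ht : (G * G * G - G)ᵀ = G * G * G - G := by
      simp [transpose_sub, transpose_mul, hGT, Matrix.mul_assoc]
    rw [ht]
    have : (G * G * G - G) * (G * G * G - G)
      = ((G * G) * (G * G)) * (G * G) - 2 * ((G * G) * (G * G)) + G * G := by noncomm_ring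
    rw [this, h4, h4]
    noncomm_ring
  have hidem : G * G = G := by
    refine sub_eq_zero.mp (eq_zero_of_transpose_mul_self_add (G * G - G) (Xᵀ * (G * G - G)) ?_)
    have ht : (G * G - G)ᵀ = G * G - G := by simp [transpose_sub, transpose_mul, hGT]
    rw [transpose_mul, ht, transpose_transpose]
    have e : (G * G - G) * X * (Xᵀ * (G * G - G)) = (G * G - G) * (G * G * G - G * G) := by
      calc _ = (G * G - G) * (G * (G * G - G)) := by simp only [hG, Matrix.mul_assoc]
        _ = _ := by noncomm_ring
    rw [e, h3]
    noncomm_ring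
  refine ⟨hidem, ?_⟩
  rw [← hidem, hGG, trace_neg, trace_mul_comm, Matrix.mul_assoc, hX, Jmat_mul_Jmat]
  simp [two_mul]

/-- When `B` is a partial isometry with `B * B = 0` and `c ^ 2 + s ^ 2 = 1`, this matrix rotates each
`v` in the initial space of `B` to `c • v + s • B v` and fixes the complement of that space. -/
def partialRotation {n : ℕ} (B : Matrix (Idx n) (Idx n) ℝ) (c s : ℝ) : Matrix (Idx n) (Idx n) ℝ :=
  1 + (c - 1) • (Bᵀ * B) + s • B

lemma partialRotation_conj {n : ℕ} {B D : Matrix (Idx n) (Idx n) ℝ} {a b c s : ℝ} (hD : Dᵀ = D)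
    (hBB : B * B = 0) (hiso : B * (Bᵀ * B) = B) (hDB : D * B = a • B) (hBD : B * D = b • B)
    (hcs : c ^ 2 + s ^ 2 = 1) :
    (partialRotation B c s)ᵀ * D * partialRotation B c s =
      D - (s ^ 2 * (b - a)) • (Bᵀ * B) + (s * a) • (B + Bᵀ) := by
  have hBtD : Bᵀ * D = a • Bᵀ := by
    rw [← hD, ← transpose_mul, hDB, transpose_smul]
  have hDBt : D * Bᵀ = b • Bᵀ := by
    rw [← hD, ← transpose_mul, hBD, transpose_smul]
  have hBtBt : Bᵀ * Bᵀ = 0 := by rw [← transpose_mul, hBB, transpose_zero]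
  have hDW : D * (Bᵀ * B) = b • (Bᵀ * B) := by
    rw [← Matrix.mul_assoc, hDBt, Matrix.smul_mul]
  have hWD : Bᵀ * B * D = b • (Bᵀ * B) := by
    rw [Matrix.mul_assoc, hBD, Matrix.mul_smul]
  have hWW : Bᵀ * B * (Bᵀ * B) = Bᵀ * B := by rw [Matrix.mul_assoc, hiso]
  have hWB : Bᵀ * B * B = 0 := by rw [Matrix.mul_assoc, hBB, Matrix.mul_zero]
  have hBtW : Bᵀ * (Bᵀ * B) = 0 := by rw [← Matrix.mul_assoc, hBtBt, Matrix.zero_mul]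
  have hWT : (Bᵀ * B)ᵀ = Bᵀ * B := by simp
  unfold partialRotation
  rw [Matrix.mul_assoc]
  simp only [transpose_add, transpose_one, transpose_smul, hWT]
  generalize hW : Bᵀ * B = W at *
  simp only [Matrix.mul_add, Matrix.add_mul, Matrix.mul_one, Matrix.one_mul, Matrix.mul_smul,
    Matrix.smul_mul, hDW, hDB, hWD, hWW, hWB, hBtD, hBtW, hW, smul_zero, add_zero]
  match_scalars
  · ring
  · linear_combination b * hcs
  · ring
  · ring

lemma eq_zero_of_descent (hD : Dᵀ = D) (hX : Symplectic X)
    (hloc : ∀ᶠ Y in nhds X, Symplectic Y → (Xᵀ * D * X).trace ≤ (Yᵀ * D * Y).trace)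
    {B : Matrix (Idx n) (Idx n) ℝ} {a b : ℝ} (hJB : Jmat n * B = B * Jmat n)
    (hiso : B * (Bᵀ * B) = B) (hGB : X * Xᵀ * B = 0) (hBG : B * (X * Xᵀ) = B)
    (hDB : D * B = a • B) (hBD : B * D = b • B) (hab : a < b) : B = 0 := by
  have hBB : B * B = 0 := by
    calc B * B = B * (X * Xᵀ) * B := by rw [hBG]
      _ = 0 := by rw [Matrix.mul_assoc, hGB, Matrix.mul_zero]
  have hXB : Xᵀ * B = 0 := eq_zero_of_transpose_mul_self _ (by
    rw [transpose_mul, transpose_transpose, Matrix.mul_assoc, ← Matrix.mul_assoc X, hGB,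
      Matrix.mul_zero])
  have hBX : Bᵀ * X = 0 := by
    rw [← transpose_transpose X, ← transpose_mul, hXB, transpose_zero]
  have hJBt : Jmat n * Bᵀ = Bᵀ * Jmat n := by
    have := congrArg transpose hJB
    simpa [transpose_mul, Jmat_transpose] using this.symm
  have hsymp {c s : ℝ} (hcs : c ^ 2 + s ^ 2 = 1) : Symplectic (partialRotation B c s * X) := by
    have h1 := partialRotation_conj (D := 1) (a := 1) (b := 1) transpose_one hBB hiso
      (by simp) (by simp) hcs
    have hJN : Jmat n * partialRotation B c s = partialRotation B c s * Jmat n := by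
      simp only [partialRotation, Matrix.mul_add, Matrix.add_mul, Matrix.mul_smul,
        Matrix.smul_mul, hJB, ← Matrix.mul_assoc, hJBt]
      rw [Matrix.mul_assoc Bᵀ, hJB]
      simp [Matrix.mul_assoc]
    unfold Symplectic at *
    calc (partialRotation B c s * X)ᵀ * Jmat n * (partialRotation B c s * X)
        = Xᵀ * ((partialRotation B c s)ᵀ * 1 * (Jmat n * partialRotation B c s)) * X := by
          simp only [transpose_mul, Matrix.mul_assoc, Matrix.one_mul]
      _ = Xᵀ * (((partialRotation B c s)ᵀ * 1 * partialRotation B c s) * Jmat n) * X := by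
          rw [hJN, Matrix.mul_assoc _ (partialRotation B c s)]
      _ = Xᵀ * Jmat n * X + s • (Xᵀ * B * (Jmat n * X) + Xᵀ * (Bᵀ * Jmat n) * X) := by
          rw [h1]
          simp [Matrix.mul_add, Matrix.add_mul, Matrix.mul_assoc]
      _ = Jmat k := by
          rw [hXB, ← hJBt, Matrix.mul_assoc _ (_ * Bᵀ), Matrix.mul_assoc _ Bᵀ, hBX, hX]
          simp
  have hval {c s : ℝ} (hcs : c ^ 2 + s ^ 2 = 1) :
      ((partialRotation B c s * X)ᵀ * D * (partialRotation B c s * X)).trace =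
        (Xᵀ * D * X).trace - s ^ 2 * (b - a) * (B * Bᵀ).trace := by
    have h1 := partialRotation_conj hD hBB hiso hDB hBD hcs
    have h2 : (Xᵀ * (Bᵀ * B) * X).trace = (B * Bᵀ).trace := by
      rw [Matrix.mul_assoc, trace_mul_comm, Matrix.mul_assoc, Matrix.mul_assoc, hBG,
        trace_mul_comm]
    calc _ = (Xᵀ * ((partialRotation B c s)ᵀ * D * partialRotation B c s) * X).trace := by
          simp only [transpose_mul, Matrix.mul_assoc]
      _ = (Xᵀ * D * X - (s ^ 2 * (b - a)) • (Xᵀ * (Bᵀ * B) * X)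
            + (s * a) • (Xᵀ * B * X + Xᵀ * (Bᵀ * X))).trace := by
          rw [h1]
          simp [Matrix.mul_add, Matrix.add_mul, Matrix.mul_sub, Matrix.sub_mul, Matrix.mul_assoc]
      _ = _ := by
          rw [hXB, hBX, ← h2]
          simp
  have hc : Filter.Tendsto (fun t : ℝ => partialRotation B (Real.cos t) (Real.sin t) * X)
      (nhds 0) (nhds X) := by
    have : Continuous (fun t : ℝ => partialRotation B (Real.cos t) (Real.sin t) * X) := by
      unfold partialRotation; fun_prop
    simpa [partialRotation] using this.tendsto 0
  obtain ⟨t, ht, ht0, ht1⟩ := (((hc.eventually hloc).filter_mono nhdsWithin_le_nhds).and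
    (Ioo_mem_nhdsGT (zero_lt_one' ℝ))).exists
  have hle := ht (hsymp (Real.cos_sq_add_sin_sq t))
  rw [hval (Real.cos_sq_add_sin_sq t)] at hle
  have hsin : 0 < Real.sin t := Real.sin_pos_of_pos_of_le_one ht0 ht1.le
  have hpos : 0 < Real.sin t ^ 2 * (b - a) := mul_pos (pow_pos hsin 2) (sub_pos.mpr hab)
  have hnn : 0 ≤ (B * Bᵀ).trace := by
    simpa using (posSemidef_self_mul_conjTranspose B).trace_nonneg
  have h0 : (B * Bᴴ).trace = 0 := by
    rw [conjTranspose_eq_transpose_of_trivial]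
    nlinarith
  exact trace_mul_conjTranspose_self_eq_zero_iff.mp h0

lemma complex_linear_part_isometry {J E : Matrix (Idx n) (Idx n) ℝ} {r : ℝ} (hJ : J * J = -1)
    (hJT : Jᵀ = -J) (h1 : Eᵀ * J * E = 0) (h2 : E * J * Eᵀ = 0) (h3 : E * Eᵀ * E = r • E) :
    (E - J * E * J) * ((E - J * E * J)ᵀ * (E - J * E * J)) = r • (E - J * E * J) := by
  have hT : (E - J * E * J)ᵀ = Eᵀ - J * Eᵀ * J := by
    simp [transpose_sub, transpose_mul, hJT, Matrix.mul_assoc]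
  have e1 : (Eᵀ - J * Eᵀ * J) * (E - J * E * J) = Eᵀ * E - J * (Eᵀ * E) * J := by
    calc _ = Eᵀ * E - (Eᵀ * J * E) * J - J * (Eᵀ * J * E) + J * (Eᵀ * (J * J) * E) * J := by
          noncomm_ring
      _ = _ := by rw [h1, hJ]; simp [sub_eq_add_neg]
  rw [hT, e1]
  calc _ = E * Eᵀ * E - (E * J * Eᵀ) * E * J - J * (E * J * Eᵀ) * E
          + J * (E * (J * J) * Eᵀ * E) * J := by noncomm_ring
    _ = E * Eᵀ * E - J * (E * Eᵀ * E) * J := by rw [h2, hJ]; simp [sub_eq_add_neg]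
    _ = _ := by rw [h3]; simp [smul_sub]

lemma single_mul_mul_single_transpose (A : Matrix (Idx n) (Idx n) ℝ) (i j : Idx n) :
    single i j 1 * A * (single i j 1)ᵀ = A j j • single i i 1 := by
  simp [single_mul_mul_single, smul_single]

lemma single_transpose_mul_mul_single (A : Matrix (Idx n) (Idx n) ℝ) (i j : Idx n) :
    (single i j 1)ᵀ * A * single i j 1 = A i i • single j j 1 := by
  simp [single_mul_mul_single, smul_single]

lemma diag_eq_zero_of_transpose_eq_neg {A : Matrix (Idx n) (Idx n) ℝ} (hA : Aᵀ = -A) (i : Idx n) :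
    A i i = 0 := by
  have := congrFun (congrFun hA i) i
  rw [transpose_apply, Matrix.neg_apply] at this
  linarith

lemma projection_diag_nonneg {P : Matrix (Idx n) (Idx n) ℝ} (hT : Pᵀ = P) (hP : P * P = P)
    (i : Idx n) : 0 ≤ P i i := by
  have h : P i i = ∑ a, P i a * P i a := by
    conv_lhs => rw [← hP, mul_apply]
    refine Finset.sum_congr rfl fun a _ => ?_
    conv_lhs => rw [← hT, transpose_apply, hT]
    rw [← transpose_apply P, hT]
  rw [h]
  exact Finset.sum_nonneg fun a _ => mul_self_nonneg _

lemma occupation_alternative {d : Fin n → ℝ} (hX : Symplectic X)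
    (hloc : ∀ᶠ Y in nhds X, Symplectic Y →
      (Xᵀ * diagPair d * X).trace ≤ (Yᵀ * diagPair d * Y).trace)
    (hDG : diagPair d * (X * Xᵀ) = X * Xᵀ * diagPair d)
    (hJG : Jmat n * (X * Xᵀ) = X * Xᵀ * Jmat n) (hGG : X * Xᵀ * (X * Xᵀ) = X * Xᵀ)
    {i j : Fin n} (hij : d i < d j) :
    (X * Xᵀ) (.inl j) (.inl j) = 0 ∨ (X * Xᵀ) (.inl i) (.inl i) = 1 := by
  have hDT := diagPair_transpose d
  have hDJ := diagPair_mul_Jmat d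
  have hJ := Jmat_mul_Jmat n
  have hJT := Jmat_transpose n
  have hGT : (X * Xᵀ)ᵀ = X * Xᵀ := by simp
  have hDs : diagPair d * single (.inl i) (.inl j) 1 = d i • single (.inl i) (.inl j) 1 := by
    rw [diagPair_eq_diagonal]
    ext a b
    by_cases h : Sum.inl i = a
    · subst h; simp [diagonal_mul, single_apply]
    · simp [diagonal_mul, h]
  have hsD : single (.inl i) (.inl j) 1 * diagPair d = d j • single (.inl i) (.inl j) 1 := by
    rw [diagPair_eq_diagonal]
    ext a b
    by_cases h : Sum.inl j = b
    · subst h; simp [mul_diagonal, single_apply]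
    · simp [mul_diagonal, h]
  have hsA := fun A => single_mul_mul_single_transpose A (.inl i : Idx n) (.inl j)
  have hAs := fun A => single_transpose_mul_mul_single A (.inl i : Idx n) (.inl j)
  set s : Matrix (Idx n) (Idx n) ℝ := single (.inl i) (.inl j) 1
  have hmain {B : Matrix (Idx n) (Idx n) ℝ} := eq_zero_of_descent (B := B) (a := d i) (b := d j)
    hDT hX hloc
  generalize X * Xᵀ = G at hDG hJG hGG hGT hmain ⊢
  generalize diagPair d = D at hDG hDT hDJ hDs hsD hmain
  generalize Jmat n = J at hJ hJT hDJ hJG hmain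
  clear hloc
  set P := 1 - G with hP
  have hPT : Pᵀ = P := by rw [hP, transpose_sub, transpose_one, hGT]
  have hPP : P * P = P := by
    rw [hP]; simp [Matrix.mul_sub, Matrix.sub_mul, hGG]
  have hGP : G * P = 0 := by rw [hP, Matrix.mul_sub, Matrix.mul_one, hGG, sub_self]
  have hJP : J * P = P * J := by
    rw [hP, Matrix.mul_sub, Matrix.sub_mul, hJG, Matrix.mul_one, Matrix.one_mul]
  have hDP : D * P = P * D := by
    rw [hP, Matrix.mul_sub, Matrix.sub_mul, hDG, Matrix.mul_one, Matrix.one_mul]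
  have hq := projection_diag_nonneg hGT hGG (.inl j)
  have hp := projection_diag_nonneg hPT hPP (.inl i)
  have hpi : P (.inl i) (.inl i) = 1 - G (.inl i) (.inl i) := by simp [hP]
  by_contra! hne
  have hq' : 0 < G (.inl j) (.inl j) := lt_of_le_of_ne hq hne.1.symm
  have hp' : 0 < P (.inl i) (.inl i) :=
    lt_of_le_of_ne hp fun h => hne.2 (by linarith)
  set q := G (.inl j) (.inl j)
  set p := P (.inl i) (.inl i)
  set E := P * s * G with hE
  have hET : Eᵀ = G * sᵀ * P := by
    rw [hE, transpose_mul, transpose_mul, hGT, hPT, Matrix.mul_assoc]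
  have h1 : Eᵀ * J * E = 0 := by
    have hz : (J * P) (.inl i) (.inl i) = 0 := diag_eq_zero_of_transpose_eq_neg (by
      rw [transpose_mul, hPT, hJT, hJP, Matrix.mul_neg]) _
    calc Eᵀ * J * E = G * sᵀ * (P * J) * P * s * G := by
          rw [hET, hE]; simp only [Matrix.mul_assoc]
      _ = G * (sᵀ * (J * (P * P)) * s) * G := by
          rw [← hJP]; simp only [Matrix.mul_assoc]
      _ = 0 := by rw [hPP, hAs, hz]; simp
  have h2 : E * J * Eᵀ = 0 := by
    have hz : (J * G) (.inl j) (.inl j) = 0 := diag_eq_zero_of_transpose_eq_neg (by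
      rw [transpose_mul, hGT, hJT, hJG, Matrix.mul_neg]) _
    calc E * J * Eᵀ = P * s * (G * J) * G * sᵀ * P := by
          rw [hET, hE]; simp only [Matrix.mul_assoc]
      _ = P * (s * (J * (G * G)) * sᵀ) * P := by
          rw [← hJG]; simp only [Matrix.mul_assoc]
      _ = 0 := by rw [hGG, hsA, hz]; simp
  have hEE : E * Eᵀ = q • (P * single (.inl i) (.inl i) 1 * P) := by
    calc E * Eᵀ = P * (s * (G * G) * sᵀ) * P := by
          rw [hET, hE]; simp only [Matrix.mul_assoc]
      _ = _ := by rw [hGG, hsA, Matrix.mul_smul, Matrix.smul_mul]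
  have h3 : E * Eᵀ * E = (p * q) • E := by
    have hss : single (.inl i) (.inl i) 1 * P * s = p • s := by
      rw [single_mul_mul_single]; simp [s, p, smul_single]
    calc E * Eᵀ * E = q • (P * (single (.inl i) (.inl i) 1 * (P * P) * s) * G) := by
          rw [hEE, hE]; simp only [Matrix.mul_assoc, Matrix.smul_mul]
      _ = (p * q) • E := by
          rw [hPP, hss, hE, Matrix.mul_smul, Matrix.smul_mul, smul_smul, mul_comm p q]
  set C := E - J * E * J with hC
  have hCC : C * (Cᵀ * C) = (p * q) • C := complex_linear_part_isometry hJ hJT h1 h2 h3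
  have hpq : 0 < p * q := mul_pos hp' hq'
  have hGE : G * E = 0 := by
    rw [hE, ← Matrix.mul_assoc, ← Matrix.mul_assoc, hGP]; simp
  have hEG : E * G = E := by rw [hE, Matrix.mul_assoc, hGG]
  have hDE : D * E = d i • E := by
    rw [hE, ← Matrix.mul_assoc, ← Matrix.mul_assoc, hDP, Matrix.mul_assoc P, hDs]; simp
  have hED : E * D = d j • E := by
    rw [hE, Matrix.mul_assoc, ← hDG, ← Matrix.mul_assoc, Matrix.mul_assoc P, hsD]; simp
  have hJC : J * C = C * J := by
    calc J * C = J * E - (J * J) * E * J := by rw [hC]; noncomm_ring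
      _ = E * J - J * E * (J * J) := by rw [hJ]; noncomm_ring
      _ = C * J := by rw [hC]; noncomm_ring
  have hGC : G * C = 0 := by
    calc G * C = G * E - (G * J) * E * J := by rw [hC]; noncomm_ring
      _ = G * E - J * (G * E) * J := by rw [← hJG]; noncomm_ring
      _ = 0 := by rw [hGE]; simp
  have hCG : C * G = C := by
    calc C * G = E * G - J * E * (J * G) := by rw [hC]; noncomm_ring
      _ = E * G - J * (E * G) * J := by rw [hJG]; noncomm_ring
      _ = C := by rw [hEG]
  have hDC : D * C = d i • C := by
    calc D * C = D * E - (D * J) * E * J := by rw [hC]; noncomm_ring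
      _ = D * E - J * (D * E) * J := by rw [hDJ]; noncomm_ring
      _ = d i • C := by rw [hDE, hC]; simp [smul_sub]
  have hCD : C * D = d j • C := by
    calc C * D = E * D - J * E * (J * D) := by rw [hC]; noncomm_ring
      _ = E * D - J * (E * D) * J := by rw [← hDJ]; noncomm_ring
      _ = d j • C := by rw [hED, hC]; simp [smul_sub]
  have hroot : (√(p * q))⁻¹ * (√(p * q))⁻¹ * (p * q) = 1 := by
    rw [← mul_inv, Real.mul_self_sqrt hpq.le, inv_mul_cancel₀ hpq.ne']
  have hC0 : C = 0 := by
    have hB := hmain (B := (√(p * q))⁻¹ • C) (by simp [hJC])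
      (by
        rw [transpose_smul]
        simp only [Matrix.smul_mul, Matrix.mul_smul, hCC, smul_smul]
        congr 1
        linear_combination (√(p * q))⁻¹ * hroot)
      (by simp [hGC]) (by simp [hCG]) (by rw [Matrix.mul_smul, hDC, smul_comm]) (by rw [Matrix.smul_mul, hCD, smul_comm]) hij
    exact (smul_eq_zero.mp hB).resolve_left (inv_ne_zero (Real.sqrt_pos.mpr hpq).ne')
  have hEE0 : E * Eᵀ = 0 := by
    calc E * Eᵀ = C * Eᵀ + J * (E * J * Eᵀ) := by rw [hC]; noncomm_ring
      _ = 0 := by rw [hC0, h2]; simp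
  have hz := congrArg trace hEE0
  rw [hEE, trace_smul, trace_mul_comm, ← Matrix.mul_assoc, hPP, trace_mul_single, trace_zero] at hz
  simp only [smul_eq_mul, MulOpposite.op_one, one_smul] at hz
  exact (mul_pos hq' hp').ne' hz

end LocalMin

lemma sum_mul_eq_of_alternative {n k : ℕ} (hk1 : 1 ≤ k) (hk : k ≤ n) {d g : Fin n → ℝ}
    (hmono : Monotone d) (hg0 : ∀ i, 0 ≤ g i) (hg1 : ∀ i, g i ≤ 1) (hsum : ∑ i, g i = k)
    (halt : ∀ i j, d i < d j → g j = 0 ∨ g i = 1) :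
    ∑ i, d i * g i = ∑ j : Fin k, d (Fin.castLE hk j) := by
  obtain ⟨m, rfl⟩ := Nat.exists_eq_add_of_le hk
  have hcast (j : Fin k) : Fin.castLE hk j = Fin.castAdd m j := rfl
  simp only [hcast]
  rw [Fin.sum_univ_add] at hsum ⊢
  set last : Fin k := ⟨k - 1, by omega⟩
  set μ := d (Fin.castAdd m last)
  have hlow (i : Fin k) : d (Fin.castAdd m i) ≤ μ := hmono (by
    simp only [Fin.le_def, Fin.val_castAdd, last]; omega)
  have hhigh (j : Fin m) : μ ≤ d (Fin.natAdd k j) := hmono (by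
    simp only [Fin.le_def, Fin.val_castAdd, Fin.val_natAdd, last]; omega)
  have h1 (i : Fin k) : (d (Fin.castAdd m i) - μ) * (g (Fin.castAdd m i) - 1) = 0 := by
    rcases (hlow i).eq_or_lt with h | h
    · rw [h]; ring
    by_cases hgi : g (Fin.castAdd m i) = 1
    · rw [hgi]; ring
    have hz (j : Fin m) : g (Fin.natAdd k j) = 0 :=
      (halt _ _ (h.trans_le (hhigh j))).resolve_right hgi
    have hlast : g (Fin.castAdd m last) = 0 := (halt _ _ h).resolve_right hgi
    have hlt : ∑ i : Fin k, g (Fin.castAdd m i) < ∑ _i : Fin k, (1 : ℝ) :=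
      Finset.sum_lt_sum (fun i _ => hg1 _) ⟨last, Finset.mem_univ _, by rw [hlast]; norm_num⟩
    simp [hz] at hsum hlt
    linarith
  have h2 (j : Fin m) : (d (Fin.natAdd k j) - μ) * g (Fin.natAdd k j) = 0 := by
    rcases (hhigh j).eq_or_lt with h | h
    · rw [← h]; ring
    by_cases hgj : g (Fin.natAdd k j) = 0
    · rw [hgj]; ring
    have hone (i : Fin k) : g (Fin.castAdd m i) = 1 :=
      (halt _ _ ((hlow i).trans_lt h)).resolve_left hgj
    simp [hone] at hsum
    exact absurd ((Finset.sum_eq_zero_iff_of_nonneg fun j _ => hg0 _).mp hsum j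
      (Finset.mem_univ _)) hgj
  have e1 := Finset.sum_eq_zero fun i (_ : i ∈ Finset.univ) => h1 i
  have e2 := Finset.sum_eq_zero fun j (_ : j ∈ Finset.univ) => h2 j
  simp only [sub_mul, mul_sub, mul_one, Finset.sum_sub_distrib, ← Finset.mul_sum] at e1 e2
  simp only [Finset.sum_const, Finset.card_univ, Fintype.card_fin, nsmul_eq_mul] at e1
  linear_combination e1 + e2 + μ * hsum

lemma local_minimizer_diagPair {n k : ℕ} (hk1 : 1 ≤ k) (hk : k ≤ n) {d : Fin n → ℝ}
    (hd : ∀ j, 0 < d j) (hmono : Monotone d) {X : Matrix (Idx n) (Idx k) ℝ} (hX : Symplectic X)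
    (hloc : ∀ᶠ Y in nhds X, Symplectic Y →
      (Xᵀ * diagPair d * X).trace ≤ (Yᵀ * diagPair d * Y).trace) :
    (Xᵀ * diagPair d * X).trace = 2 * ∑ j : Fin k, d (Fin.castLE hk j) := by
  obtain ⟨hDG, hJG⟩ := gram_commute_diagPair hd (stationarity (diagPair_transpose d) hX hloc)
  obtain ⟨hGG, htr⟩ := gram_idempotent hX hJG
  have halt := fun i j => occupation_alternative hX hloc hDG hJG hGG (i := i) (j := j)
  have htrace : (Xᵀ * diagPair d * X).trace = (diagPair d * (X * Xᵀ)).trace := by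
    rw [Matrix.mul_assoc, trace_mul_comm, Matrix.mul_assoc]
  have hGT : (X * Xᵀ)ᵀ = X * Xᵀ := by simp
  rw [htrace]
  set G := X * Xᵀ
  have hinr (i : Fin n) : G (.inr i) (.inr i) = G (.inl i) (.inl i) := by
    have := congrFun (congrFun hJG (.inl i)) (.inr i)
    simpa [Jmat, mul_apply, Fintype.sum_sum_type, Matrix.one_apply] using this
  have hPP : (1 - G) * (1 - G) = 1 - G := by simp [Matrix.mul_sub, Matrix.sub_mul, hGG]
  have hPT : (1 - G)ᵀ = 1 - G := by rw [transpose_sub, transpose_one, hGT]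
  rw [← sum_mul_eq_of_alternative hk1 hk hmono (g := fun i => G (.inl i) (.inl i))
    (fun i => projection_diag_nonneg hGT hGG _)
    (fun i => by simpa using projection_diag_nonneg hPT hPP (.inl i)) ?_ halt]
  · simp [diagPair_eq_diagonal, trace, diagonal_mul, Fintype.sum_sum_type, hinr, two_mul]
  · simp only [trace, diag_apply, Fintype.sum_sum_type, hinr] at htr
    linarith


/-- every local minimizer of `tr(XᵀMX)` on `Sp(2k,2n)` is a global
minimizer, i.e., attains the value `2(d₁ + … + d_k)`. -/
theorem local_minimizer_is_global {n k : ℕ} (hk1 : 1 ≤ k) (hk : k ≤ n)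
    (M : Matrix (Idx n) (Idx n) ℝ) (hM : M.PosDef)
    (d : Fin n → ℝ) (hd : ∀ j, 0 < d j) (hmono : Monotone d)
    (hW : ∃ S : Matrix (Idx n) (Idx n) ℝ, Symplectic S ∧ Sᵀ * M * S = diagPair d)
    (X0 : Matrix (Idx n) (Idx k) ℝ) (hX0 : Symplectic X0)
    (ε : ℝ) (hε : 0 < ε)
    (hloc : ∀ X : Matrix (Idx n) (Idx k) ℝ, Symplectic X → ‖X - X0‖ < ε →
      (X0ᵀ * M * X0).trace ≤ (Xᵀ * M * X).trace) :
    (X0ᵀ * M * X0).trace = 2 * ∑ j : Fin k, d (Fin.castLE hk j) := by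
  obtain ⟨S, hS, hSM⟩ := hW
  have hSS : S * S⁻¹ = 1 := mul_nonsing_inv _ (isUnit_det_of_left_inverse hS.left_inverse)
  have hval (Y : Matrix (Idx n) (Idx k) ℝ) :
      ((S * Y)ᵀ * M * (S * Y)).trace = (Yᵀ * diagPair d * Y).trace := by
    rw [← hSM, transpose_mul]
    simp only [Matrix.mul_assoc]
  have hSX : S * (S⁻¹ * X0) = X0 := by rw [← Matrix.mul_assoc, hSS, Matrix.one_mul]
  have hev : ∀ᶠ X in nhds X0, Symplectic X →
      (X0ᵀ * M * X0).trace ≤ (Xᵀ * M * X).trace := by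
    filter_upwards [Metric.ball_mem_nhds X0 hε] with X hXball hXs
    exact hloc X hXs (by rwa [← dist_eq_norm])
  have hc : Filter.Tendsto (fun Y : Matrix (Idx n) (Idx k) ℝ => S * Y) (nhds (S⁻¹ * X0))
      (nhds X0) := by
    have : Continuous (fun Y : Matrix (Idx n) (Idx k) ℝ => S * Y) := by fun_prop
    simpa only [hSX] using this.tendsto (S⁻¹ * X0)
  have hval0 := hval (S⁻¹ * X0)
  rw [hSX] at hval0
  rw [hval0]
  refine local_minimizer_diagPair hk1 hk hd hmono (hS.inv.mul hX0) ?_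
  filter_upwards [hc.eventually hev] with Y hY hYs
  rw [← hval0, ← hval Y]
  exact hY (hS.mul hYs)
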